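/- Let T be an invertible nonsingular transformation of a σ-finite measure space (X,μ) with the following property: for every pair of measurable sets C, D of positive measure there exists n ∈ ℤ with n ≠ 0 such that μ(C ∩ Tⁿ(C)) > 0 and μ(D ∩ Tⁿ(C)) > 0. Suppose A, B are measurable sets of positive measure such that every n ∈ ℤ, n ≠ 0, satisfying μ(A ∩ Tⁿ(A)) > 0 and μ(B ∩ Tⁿ(A)) > 0 is strictly positive. Then the set of such n is unbounded above: for every N ∈ ℕ there exists n > N with μ(A ∩ Tⁿ(A)) > 0 and μ(B ∩ Tⁿ(A)) > 0. -/

import Mathlib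

open MeasureTheory Filter Set
open scoped ENNReal

/-- The `n`-th iterate (for `n ∈ ℤ`) of an invertible transformation. -/
def iterZ {X : Type*} (T : X ≃ X) (n : ℤ) : X → X := ⇑(T ^ n)

theorem quasiMeasurePreserving_iterZ {X : Type*} [MeasurableSpace X] {μ : Measure X}
    {T : X ≃ᵐ X} (hns : Measure.QuasiMeasurePreserving T μ μ)
    (hns' : Measure.QuasiMeasurePreserving T.symm μ μ) (n : ℤ) :
    Measure.QuasiMeasurePreserving (iterZ T.toEquiv n) μ μ := by
  cases n with
  | ofNat n =>
    have h := hns.iterate n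
    rwa [show (⇑T)^[n] = iterZ T.toEquiv (Int.ofNat n) by
      simp [iterZ, Equiv.Perm.coe_pow]] at h
  | negSucc n =>
    have h := hns'.iterate (n + 1)
    rwa [show (⇑T.symm)^[n + 1] = iterZ T.toEquiv (Int.negSucc n) by
      rw [iterZ, zpow_negSucc, ← inv_pow, Equiv.Perm.coe_pow]; rfl] at h

theorem iterZ_image_eq_preimage {X : Type*} (T : X ≃ X) (n : ℤ) (A : Set X) :
    iterZ T n '' A = iterZ T (-n) ⁻¹' A := by
  simp only [iterZ, zpow_neg]
  exact Equiv.image_eq_preimage_symm _ _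

theorem iterZ_iterZ {X : Type*} (T : X ≃ X) (m n : ℤ) (x : X) :
    iterZ T m (iterZ T n x) = iterZ T (m + n) x := by
  simp [iterZ, zpow_add]

/-- If almost every point of `A` lies in `T⁻ⁿ(A)`, then `Tʲ(A)` is contained in `Tʲ⁻ᵏⁿ(A)` up to
a null set, so the latter meets every set which the former meets. -/
theorem measure_inter_iterZ_image_pos {X : Type*} [MeasurableSpace X] {μ : Measure X}
    {T : X ≃ᵐ X} (hns : Measure.QuasiMeasurePreserving T μ μ)
    (hns' : Measure.QuasiMeasurePreserving T.symm μ μ) {A : Set X} {n : ℤ}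
    (hA : μ (A \ iterZ T.toEquiv (-n) '' A) = 0) {D : Set X} {j : ℤ}
    (hD : 0 < μ (D ∩ iterZ T.toEquiv j '' A)) (k : ℕ) :
    0 < μ (D ∩ iterZ T.toEquiv (j - k * n) '' A) := by
  induction k with
  | zero => simpa using hD
  | succ k ih =>
    set i : ℤ := j - k * n with hi
    have hij : j - (k + 1 : ℕ) * n = i - n := by rw [hi]; push_cast; ring
    rw [hij]
    have hnull := (quasiMeasurePreserving_iterZ hns hns' (-i)).preimage_null hA
    by_contra hzero
    refine ih.ne' (measure_mono_null ?_ (measure_union_null (nonpos_iff_eq_zero.mp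
      (not_lt.mp hzero)) hnull))
    rintro x ⟨hxD, hx⟩
    simp only [iterZ_image_eq_preimage, mem_union, mem_inter_iff, mem_preimage, Set.mem_sdiff,
      iterZ_iterZ, neg_neg] at hx ⊢
    rw [show -(i - n) = n + -i by ring]
    tauto

/-- If all good times for `A`, `B` are positive, then `A` has a subset of positive measure which
is disjoint from its image under `Tⁿ`. -/
theorem exists_subset_disjoint_iterZ_image {X : Type*} [MeasurableSpace X] {μ : Measure X}
    {T : X ≃ᵐ X} (hns : Measure.QuasiMeasurePreserving T μ μ)
    (hns' : Measure.QuasiMeasurePreserving T.symm μ μ) {A B : Set X} (hA : MeasurableSet A)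
    (hgood : ∃ n : ℤ, 0 < μ (A ∩ iterZ T.toEquiv n '' A) ∧ 0 < μ (B ∩ iterZ T.toEquiv n '' A))
    (hpos : ∀ n : ℤ, n ≠ 0 →
      (0 < μ (A ∩ iterZ T.toEquiv n '' A) ∧ 0 < μ (B ∩ iterZ T.toEquiv n '' A)) → 0 < n)
    {n : ℤ} (hn : 0 < n) :
    ∃ A' ⊆ A, MeasurableSet A' ∧ 0 < μ A' ∧ A' ∩ iterZ T.toEquiv n '' A' = ∅ := by
  refine ⟨A \ iterZ T.toEquiv (-n) '' A, sdiff_subset, hA.diff ?_, ?_, ?_⟩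
  · rw [iterZ_image_eq_preimage]
    exact (quasiMeasurePreserving_iterZ hns hns' _).measurable hA
  · refine pos_iff_ne_zero.mpr fun hnull => ?_
    obtain ⟨m, hmA, hmB⟩ := hgood
    have hneg : m - (m.toNat + 1 : ℕ) * n < 0 := by
      have := Int.self_le_toNat m
      push_cast
      nlinarith
    exact hneg.not_gt (hpos _ hneg.ne ⟨measure_inter_iterZ_image_pos hns hns' hnull hmA _,
      measure_inter_iterZ_image_pos hns hns' hnull hmB _⟩)
  · rw [eq_empty_iff_forall_notMem]
    rintro _ ⟨⟨hyA, -⟩, y, ⟨-, hy⟩, rfl⟩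
    rw [iterZ_image_eq_preimage, neg_neg] at hy
    exact hy hyA

/-- Suppose the invertible nonsingular transformation `T` satisfies: for all positive
measure sets `C`, `D` there is a nonzero `n ∈ ℤ` with `μ(C ∩ Tⁿ(C)) > 0` and
`μ(D ∩ Tⁿ(C)) > 0`.  If `A`, `B` are positive measure sets for which every nonzero
`n ∈ ℤ` with `μ(A ∩ Tⁿ(A)) > 0` and `μ(B ∩ Tⁿ(A)) > 0` is strictly positive, then the
set of such `n` is unbounded above. -/
theorem good_times_unbounded {X : Type*} [MeasurableSpace X] (μ : Measure X)
    [SigmaFinite μ] (T : X ≃ᵐ X)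
    (hns : Measure.QuasiMeasurePreserving (⇑T) μ μ)
    (hns' : Measure.QuasiMeasurePreserving (⇑T.symm) μ μ)
    (hprop : ∀ C D : Set X, MeasurableSet C → MeasurableSet D → 0 < μ C → 0 < μ D →
      ∃ n : ℤ, n ≠ 0 ∧ 0 < μ (C ∩ iterZ T.toEquiv n '' C) ∧
        0 < μ (D ∩ iterZ T.toEquiv n '' C))
    (A B : Set X) (hA : MeasurableSet A) (hB : MeasurableSet B)
    (hApos : 0 < μ A) (hBpos : 0 < μ B)
    (hpos : ∀ n : ℤ, n ≠ 0 →
      (0 < μ (A ∩ iterZ T.toEquiv n '' A) ∧ 0 < μ (B ∩ iterZ T.toEquiv n '' A)) → 0 < n) :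
    ∀ N : ℕ, ∃ n : ℤ, (N : ℤ) < n ∧
      0 < μ (A ∩ iterZ T.toEquiv n '' A) ∧ 0 < μ (B ∩ iterZ T.toEquiv n '' A) := by
  intro N
  have hsub : ∃ A' ⊆ A, MeasurableSet A' ∧ 0 < μ A' ∧
      ∀ n : ℤ, 0 < n → n ≤ N → A' ∩ iterZ T.toEquiv n '' A' = ∅ := by
    induction N with
    | zero => exact ⟨A, Subset.rfl, hA, hApos, fun n h h' => by simp at h'; omega⟩
    | succ N ih =>
      obtain ⟨A₁, hA₁A, hA₁, hA₁pos, hdisj⟩ := ih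
      obtain ⟨m, -, hm⟩ := hprop A₁ B hA₁ hB hA₁pos hBpos
      obtain ⟨A₂, hA₂A₁, hA₂, hA₂pos, hdisj'⟩ :=
        exists_subset_disjoint_iterZ_image hns hns' hA₁ ⟨m, hm⟩
          (fun n hn h => hpos n hn ⟨h.1.trans_le (by gcongr), h.2.trans_le (by gcongr)⟩)
          (n := (N + 1 : ℕ)) (by positivity)
      refine ⟨A₂, hA₂A₁.trans hA₁A, hA₂, hA₂pos, fun n hn hnN => ?_⟩
      rcases hnN.eq_or_lt with rfl | hlt
      · exact hdisj'
      · exact subset_empty_iff.mp ((inter_subset_inter hA₂A₁ (image_mono hA₂A₁)).trans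
          (hdisj n hn (by push_cast at hlt; omega)).subset)
  obtain ⟨A', hA'A, hA', hA'pos, hdisj⟩ := hsub
  obtain ⟨n, hn, hnA, hnB⟩ := hprop A' B hA' hB hA'pos hBpos
  have hA'' : 0 < μ (A ∩ iterZ T.toEquiv n '' A) := hnA.trans_le (by gcongr)
  have hB'' : 0 < μ (B ∩ iterZ T.toEquiv n '' A) := hnB.trans_le (by gcongr)
  refine ⟨n, ?_, hA'', hB''⟩
  by_contra! hle
  simp [hdisj n (hpos n hn ⟨hA'', hB''⟩) hle] at hnA
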